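/- arXiv:1909.11885 — 3 statements merged into one kernel-verified Lean document; each statement's English description precedes it below -/
import Mathlib

section
/- Let η ∈ ⋀²W satisfy η^m ≠ 0 in ⋀^{2m}W. Then for every integer k with 0 ≤ k ≤ m, the K-linear map ⋀^{m−k}W → ⋀^{m+k}W sending ω to η^k ∧ ω is an isomorphism. -/
open ExteriorAlgebra

section LefschetzAux

open CliffordAlgebra (contractLeft contractLeft_ι_mul contractLeft_ι)

variable {R M : Type*} [CommRing R] [AddCommGroup M] [Module R M]

/-- Contraction with a linear form lowers the exterior degree by one. -/
theorem ExteriorAlgebra.contractLeft_mem_exteriorPower (d : Module.Dual R M) (n : ℕ)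
    {x : ExteriorAlgebra R M} (hx : x ∈ ⋀[R]^(n + 1) M) :
    contractLeft (Q := (0 : QuadraticForm R M)) d x ∈ ⋀[R]^n M := by
  induction n generalizing x with
  | zero =>
    rw [exteriorPower, zero_add, pow_one] at hx
    obtain ⟨v, rfl⟩ := hx
    rw [exteriorPower, pow_zero]
    exact (contractLeft_ι (Q := (0 : QuadraticForm R M)) d v).symm ▸ Submodule.algebraMap_mem _
  | succ n ih =>
    rw [exteriorPower, pow_succ'] at hx
    induction hx using Submodule.mul_induction_on' with
    | mem_mul_mem a ha y hy =>
      obtain ⟨v, rfl⟩ := ha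
      have h := contractLeft_ι_mul (Q := (0 : QuadraticForm R M)) d v y
      refine h.symm ▸ Submodule.sub_mem _ (Submodule.smul_mem _ _ hy) ?_
      rw [exteriorPower, pow_succ']
      exact Submodule.mul_mem_mul ⟨v, rfl⟩ (ih hy)
    | add a _ b _ ha hb =>
      rw [map_add]
      exact Submodule.add_mem _ ha hb

/-- Euler's formula: contracting with a dual basis and wedging back multiplies by the degree. -/
theorem ExteriorAlgebra.sum_ι_mul_contractLeft_coord {I : Type*} [Fintype I]
    (b : Module.Basis I R M) (n : ℕ) {x : ExteriorAlgebra R M} (hx : x ∈ ⋀[R]^n M) :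
    ∑ i, ι R (b i) * contractLeft (Q := (0 : QuadraticForm R M)) (b.coord i) x = n • x := by
  induction n generalizing x with
  | zero =>
    rw [exteriorPower, pow_zero] at hx
    obtain ⟨r, rfl⟩ := Submodule.mem_one.1 hx
    rw [zero_smul]
    refine Finset.sum_eq_zero fun i _ => ?_
    have h := CliffordAlgebra.contractLeft_algebraMap (0 : QuadraticForm R M) (b.coord i) r
    exact (congrArg _ h).trans (mul_zero _)
  | succ n ih =>
    rw [exteriorPower, pow_succ'] at hx
    induction hx using Submodule.mul_induction_on' with
    | mem_mul_mem a ha y hy =>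
      obtain ⟨v, rfl⟩ := ha
      have h (i : I) : ι R (b i) *
          contractLeft (Q := (0 : QuadraticForm R M)) (b.coord i) (ι R v * y) =
          ι R (b.repr v i • b i) * y + ι R v *
            (ι R (b i) * contractLeft (Q := (0 : QuadraticForm R M)) (b.coord i) y) := by
        have h₁ := contractLeft_ι_mul (Q := (0 : QuadraticForm R M)) (d := b.coord i) v y
        have h₂ := eq_neg_of_add_eq_zero_left (ι_add_mul_swap (R := R) (b i) v)
        refine (congrArg (ι R (b i) * ·) h₁).trans ?_
        change ι R (b i) * (b.repr v i • y - ι R v *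
          contractLeft (Q := (0 : QuadraticForm R M)) (b.coord i) y) = _
        rw [mul_sub, ← mul_assoc, h₂, map_smul, mul_smul_comm, smul_mul_assoc, neg_mul,
          sub_neg_eq_add, mul_assoc]
      simp_rw [h]
      rw [Finset.sum_add_distrib, ← Finset.mul_sum, ih hy, ← Finset.sum_mul, ← map_sum,
        b.sum_repr, succ_nsmul', mul_smul_comm]
    | add a _ c _ ha hc =>
      simp_rw [map_add, mul_add, Finset.sum_add_distrib, ha, hc, smul_add]

theorem ExteriorAlgebra.commute_of_mem_exteriorPower_two {η : ExteriorAlgebra R M}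
    (hη : η ∈ ⋀[R]^2 M) (x : ExteriorAlgebra R M) : Commute η x := by
  induction x using ExteriorAlgebra.induction with
  | algebraMap r => exact (Algebra.commutes r η).symm
  | mul a b ha hb => exact ha.mul_right hb
  | add a b ha hb => exact ha.add_right hb
  | ι v =>
    rw [exteriorPower, pow_two] at hη
    induction hη using Submodule.mul_induction_on' with
    | mem_mul_mem a ha b hb =>
      obtain ⟨a, rfl⟩ := ha
      obtain ⟨b, rfl⟩ := hb
      have h (w : M) : ι R w * ι R v = -(ι R v * ι R w) :=
        eq_neg_of_add_eq_zero_left (ι_add_mul_swap w v)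
      rw [commute_iff_eq, mul_assoc, h b, mul_neg, ← mul_assoc, h a, neg_mul, neg_neg, mul_assoc]
    | add a _ b _ ha hb => exact ha.add_left hb

/-- Contraction satisfies the Leibniz rule when the left factor is a bivector. -/
theorem ExteriorAlgebra.contractLeft_mul_of_mem_exteriorPower_two (d : Module.Dual R M)
    {η : ExteriorAlgebra R M} (hη : η ∈ ⋀[R]^2 M) (x : ExteriorAlgebra R M) :
    contractLeft (Q := (0 : QuadraticForm R M)) d (η * x) =
      contractLeft (Q := (0 : QuadraticForm R M)) d η * x +
        η * contractLeft (Q := (0 : QuadraticForm R M)) d x := by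
  rw [exteriorPower, pow_two] at hη
  induction hη using Submodule.mul_induction_on' with
  | mem_mul_mem a ha b hb =>
    obtain ⟨a, rfl⟩ := ha
    obtain ⟨b, rfl⟩ := hb
    have h (v : M) (y : ExteriorAlgebra R M) :
        contractLeft (Q := (0 : QuadraticForm R M)) d (ι R v * y) =
          d v • y - ι R v * contractLeft (Q := (0 : QuadraticForm R M)) d y :=
      contractLeft_ι_mul (d := d) v y
    have h' : contractLeft (Q := (0 : QuadraticForm R M)) d (ι R b) =
        algebraMap R (ExteriorAlgebra R M) (d b) := contractLeft_ι _ d b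
    rw [mul_assoc, h, h, h, h', ← Algebra.commutes, ← Algebra.smul_def]
    simp only [mul_sub, sub_mul, mul_assoc, smul_mul_assoc, mul_smul_comm]
    abel
  | add a _ b _ ha hb =>
    rw [add_mul, map_add, ha, hb, map_add, add_mul, add_mul]
    abel

theorem ExteriorAlgebra.mul_contractLeft_pow_mul (d : Module.Dual R M)
    {η : ExteriorAlgebra R M} (hη : η ∈ ⋀[R]^2 M) (k : ℕ) (x : ExteriorAlgebra R M) :
    η * contractLeft (Q := (0 : QuadraticForm R M)) d (η ^ k * x) =
      k • (contractLeft (Q := (0 : QuadraticForm R M)) d η * (η ^ k * x)) +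
        η ^ (k + 1) * contractLeft (Q := (0 : QuadraticForm R M)) d x := by
  induction k with
  | zero => simp
  | succ k ih =>
    have hc (y : ExteriorAlgebra R M) : η * (contractLeft (Q := (0 : QuadraticForm R M)) d η * y) =
        contractLeft (Q := (0 : QuadraticForm R M)) d η * (η * y) :=
      (commute_of_mem_exteriorPower_two hη _).left_comm y
    rw [pow_succ' η k, mul_assoc, contractLeft_mul_of_mem_exteriorPower_two d hη, ih, mul_add,
      mul_add, hc, mul_smul_comm, hc, ← add_assoc, succ_nsmul', ← mul_assoc η (η ^ (k + 1)),
      ← pow_succ']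

end LefschetzAux

/-- Wedging with `η ^ k` is injective in degree `n` as soon as `η ^ (n + k) ≠ 0`. -/
theorem ExteriorAlgebra.eq_zero_of_pow_mul_eq_zero {K W : Type*} [Field K] [CharZero K]
    [AddCommGroup W] [Module K W] [FiniteDimensional K W] {η : ExteriorAlgebra K W}
    (hη : η ∈ ⋀[K]^2 W) (n k : ℕ) (hpow : η ^ (n + k) ≠ 0) {x : ExteriorAlgebra K W}
    (hx : x ∈ ⋀[K]^n W) (h : η ^ k * x = 0) : x = 0 := by
  induction n generalizing k x with
  | zero =>
    rw [exteriorPower, pow_zero] at hx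
    obtain ⟨r, rfl⟩ := Submodule.mem_one.1 hx
    rw [← Algebra.commutes, ← Algebra.smul_def, smul_eq_zero] at h
    rw [zero_add] at hpow
    rw [h.resolve_right hpow, map_zero]
  | succ n ih =>
    have hd (d : Module.Dual K W) :
        CliffordAlgebra.contractLeft (Q := (0 : QuadraticForm K W)) d x = 0 := by
      refine ih (k + 1) ?_ (contractLeft_mem_exteriorPower d n hx) ?_
      · rwa [← add_assoc, add_right_comm]
      · have h' := mul_contractLeft_pow_mul d hη k x
        rw [h] at h'
        simpa using h'.symm
    have hE := sum_ι_mul_contractLeft_coord (Module.finBasis K W) (n + 1) hx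
    simp only [hd, mul_zero, Finset.sum_const_zero] at hE
    rw [← Nat.cast_smul_eq_nsmul K] at hE
    exact (smul_eq_zero.1 hE.symm).resolve_left (Nat.cast_ne_zero.2 n.succ_ne_zero)

/-- Let `K` be a field of characteristic zero and `W` a `K`-vector space of
dimension `2m`, `m ≥ 1`.  Let `η ∈ ⋀²W` satisfy `η^m ≠ 0` in `⋀^{2m}W`.  Then for every
integer `k` with `0 ≤ k ≤ m`, the `K`-linear map `⋀^{m−k}W → ⋀^{m+k}W`, `ω ↦ η^k ∧ ω`, is an
isomorphism.  (We express "is an isomorphism" by saying that wedging with `η^k` is injective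
on `⋀^{m−k}W` and its image is exactly `⋀^{m+k}W` inside the exterior algebra.) -/
theorem hardLefschetz_exteriorPower
    (K W : Type*) [Field K] [CharZero K] [AddCommGroup W] [Module K W]
    [FiniteDimensional K W] (m : ℕ) (hm : 1 ≤ m) (hdim : Module.finrank K W = 2 * m)
    (η : ExteriorAlgebra K W) (hη : η ∈ ⋀[K]^2 W) (hηm : η ^ m ≠ 0) :
    ∀ k : ℕ, k ≤ m →
      Function.Injective
        (fun ω : ⋀[K]^(m - k) W => η ^ k * (ω : ExteriorAlgebra K W)) ∧
      Set.range (fun ω : ⋀[K]^(m - k) W => η ^ k * (ω : ExteriorAlgebra K W)) =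
        (⋀[K]^(m + k) W : Set (ExteriorAlgebra K W)) := by
  intro k hk
  let L : ⋀[K]^(m - k) W →ₗ[K] ExteriorAlgebra K W :=
    LinearMap.mulLeft K (η ^ k) ∘ₗ (⋀[K]^(m - k) W).subtype
  have hinj : Function.Injective L := by
    rw [injective_iff_map_eq_zero]
    intro ω hω
    exact Subtype.ext (eq_zero_of_pow_mul_eq_zero hη (m - k) k
      (by rwa [Nat.sub_add_cancel hk]) ω.2 hω)
  refine ⟨hinj, ?_⟩
  have hle : LinearMap.range L ≤ ⋀[K]^(m + k) W := by
    rintro _ ⟨ω, rfl⟩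
    have h := SetLike.mul_mem_graded (A := fun i : ℕ => ⋀[K]^i W)
      (SetLike.pow_mem_graded k hη) ω.2
    have hdeg : k • 2 + (m - k) = m + k := by
      rw [smul_eq_mul]
      omega
    rwa [hdeg] at h
  have hrange : LinearMap.range L = ⋀[K]^(m + k) W := by
    refine Submodule.eq_of_le_of_finrank_eq hle ?_
    rw [LinearMap.finrank_range_of_inj hinj, exteriorPower.finrank_eq, exteriorPower.finrank_eq,
      hdim]
    exact Nat.choose_symm_of_eq_add (by omega)
  exact (LinearMap.coe_range L).symm.trans (congrArg SetLike.coe hrange)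
end

section
/- Let (A, f) be a graded Lefschetz structure of weight a and (B, g) a graded Lefschetz structure of weight b over a field K of characteristic zero. Equip the tensor product A ⊗ B with the grading (A ⊗ B)_n = ⊕_{i+j=n} A_i ⊗ B_j and the degree-2 operator h = f ⊗ 1 + 1 ⊗ g. Then (A ⊗ B, h) is a graded Lefschetz structure of weight a + b; that is, for every k ≥ 0, the map h^k : (A ⊗ B)_{a+b−k} → (A ⊗ B)_{a+b+k} is an isomorphism. -/
open TensorProduct

namespace DirectSum.IsInternal

variable {K V W : Type*} [Field K] [AddCommGroup V] [Module K V] [AddCommGroup W] [Module K W]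
  {A : ℤ → Submodule K V}

/-- A linear map out of an internal direct sum can be prescribed on each summand. -/
lemma exists_linearMap (hA : IsInternal A) (φ : ℤ → V →ₗ[K] W) :
    ∃ ψ : V →ₗ[K] W, ∀ i, ∀ x ∈ A i, ψ x = φ i x := by
  let e := LinearEquiv.ofBijective (coeLinearMap A) hA
  refine ⟨(toModule K ℤ W fun i => (φ i).comp (A i).subtype) ∘ₗ e.symm.toLinearMap,
    fun i x hx => ?_⟩
  have h1 : e.symm x = lof K ℤ (fun i => A i) i ⟨x, hx⟩ := by
    rw [LinearEquiv.symm_apply_eq]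
    exact (coeLinearMap_lof A i ⟨x, hx⟩).symm
  simp [h1]

/-- Linear maps agreeing on each summand of an internal direct sum are equal. -/
lemma linearMap_ext (hA : IsInternal A) {φ ψ : V →ₗ[K] W}
    (h : ∀ i, ∀ x ∈ A i, φ x = ψ x) : φ = ψ := by
  ext x
  have hx : x ∈ ⨆ i, A i := by rw [hA.submodule_iSup_eq_top]; trivial
  induction hx using Submodule.iSup_induction' with
  | mem i x hx => exact h i x hx
  | zero => simp
  | add x y _ _ hx hy => simp [hx, hy]

/-- An internal grading comes with projections onto its pieces. -/
lemma exists_projections (hA : IsInternal A) :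
    ∃ π : ℤ → Module.End K V, (∀ i, ∀ x ∈ A i, π i x = x) ∧
      (∀ i j, i ≠ j → ∀ x ∈ A j, π i x = 0) ∧ ∀ i x, π i x ∈ A i := by
  have H (i : ℤ) := hA.exists_linearMap (fun j => if j = i then (LinearMap.id : V →ₗ[K] V) else 0)
  choose π hπ using H
  have h1 : ∀ i, ∀ x ∈ A i, π i x = x := fun i x hx => by simp [hπ i i x hx]
  have h2 : ∀ i j, i ≠ j → ∀ x ∈ A j, π i x = 0 := fun i j hij x hx => by
    simp [hπ i j x hx, hij.symm]
  refine ⟨π, h1, h2, fun i x => ?_⟩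
  have hx : x ∈ ⨆ i, A i := by rw [hA.submodule_iSup_eq_top]; trivial
  induction hx using Submodule.iSup_induction' with
  | mem j x hx =>
    obtain rfl | hij := eq_or_ne i j
    · rwa [h1 i x hx]
    · rw [h2 i j hij x hx]
      exact zero_mem _
  | zero => simp
  | add x y _ _ hx hy => rw [map_add]; exact add_mem hx hy

end DirectSum.IsInternal

namespace LinearMap

variable {K V : Type*} [Field K] [AddCommGroup V] [Module K V]

/-- The trace form on `End V` is nondegenerate. -/
lemma eq_zero_of_trace_mul_eq_zero [FiniteDimensional K V] {Z : Module.End K V}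
    (hZ : ∀ X, trace K V (Z * X) = 0) : Z = 0 := by
  ext v
  refine (Module.forall_dual_apply_eq_zero_iff K _).1 fun ψ => ?_
  have h : Z * ψ.smulRight v = ψ.smulRight (Z v) := by ext; simp
  rw [← trace_smulRight, ← h, hZ]

/-- Every linear functional on `End V` is of the form `X ↦ tr (Z X)`. -/
lemma exists_eq_trace_mul [FiniteDimensional K V] (φ : Module.End K V →ₗ[K] K) :
    ∃ Z : Module.End K V, ∀ X, φ X = trace K V (Z * X) := by
  let T : Module.End K V →ₗ[K] Module.Dual K (Module.End K V) :=
    (LinearMap.mul K (Module.End K V)).compr₂ (trace K V)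
  have hinj : Function.Injective T := by
    rw [← ker_eq_bot, ker_eq_bot']
    exact fun Z hZ => eq_zero_of_trace_mul_eq_zero fun X => congr($hZ X)
  have hsurj : Function.Surjective T :=
    (injective_iff_surjective_of_finrank_eq_finrank Subspace.dual_finrank_eq.symm).1 hinj
  obtain ⟨Z, hZ⟩ := hsurj φ
  exact ⟨Z, fun X => congr($hZ.symm X)⟩

/-- `H` is a commutator with `f` as soon as it is trace-orthogonal to the centralizer of `f`. -/
lemma exists_commutator_eq [FiniteDimensional K V] (f H : Module.End K V)
    (hH : ∀ Z : Module.End K V, Z * f = f * Z → trace K V (Z * H) = 0) :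
    ∃ e : Module.End K V, f * e - e * f = H := by
  let D : Module.End K V →ₗ[K] Module.End K V := mulLeft K f - mulRight K f
  suffices H ∈ range D by
    obtain ⟨e, he⟩ := this
    exact ⟨e, by simpa [D] using he⟩
  by_contra hn
  obtain ⟨φ, hφ, hle⟩ := Submodule.exists_le_ker_of_notMem hn
  obtain ⟨Z, hZ⟩ := exists_eq_trace_mul φ
  refine hφ ((hZ H).trans (hH Z ?_))
  refine sub_eq_zero.1 (eq_zero_of_trace_mul_eq_zero fun X => ?_)
  have h1 : φ (D X) = 0 := hle ⟨X, rfl⟩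
  have h2 : Z * D X = Z * f * X - Z * X * f := by simp [D, mul_sub, mul_assoc]
  rw [hZ, h2, map_sub, trace_mul_cycle K Z X f] at h1
  rw [sub_mul, map_sub, h1]

end LinearMap

section Lefschetz

variable {K V : Type*} [Field K] [AddCommGroup V] [Module K V]

/-- The iterates of an operator of degree `d` have degree `j * d`. -/
lemma pow_apply_mem_of_degree {A : ℤ → Submodule K V} {f : Module.End K V} {d : ℤ}
    (hf : ∀ i, ∀ x ∈ A i, f x ∈ A (i + d)) (j : ℕ) {i : ℤ} {x : V} (hx : x ∈ A i) :
    (f ^ j) x ∈ A (i + j * d) := by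
  induction j with
  | zero => simpa using hx
  | succ j ih =>
    rw [pow_succ', Module.End.mul_apply]
    have := hf _ _ ih
    rwa [add_assoc, show (j : ℤ) * d + d = ((j + 1 : ℕ) : ℤ) * d by push_cast; ring] at this

/-- A Lefschetz operator `f` of weight `a` has a lowering operator `e` completing it to an
`sl₂`-triple. -/
lemma exists_lowering_of_lefschetz [FiniteDimensional K V] {A : ℤ → Submodule K V}
    (hA : DirectSum.IsInternal A) {f : Module.End K V}
    (hf : ∀ i, ∀ x ∈ A i, f x ∈ A (i + 2)) {a : ℤ}
    (hL : ∀ k : ℕ, (A (a - k)).map (f ^ k) = A (a + k) ∧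
      Disjoint (LinearMap.ker (f ^ k)) (A (a - k))) :
    ∃ e : Module.End K V, (∀ i, ∀ x ∈ A i, e x ∈ A (i - 2)) ∧
      ∀ i, ∀ x ∈ A i, f (e x) - e (f x) = ((i - a : ℤ) : K) • x := by
  obtain ⟨π, hπ, hπ0, hπm⟩ := hA.exists_projections
  obtain ⟨H, hH⟩ := hA.exists_linearMap fun i => ((i - a : ℤ) : K) • (LinearMap.id : V →ₗ[K] V)
  have hπf (i : ℤ) (k : ℕ) : f ^ k * π i = π (i + k * 2) * f ^ k :=
    hA.linearMap_ext fun j x hx => by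
      have hm := pow_apply_mem_of_degree hf k hx
      obtain rfl | hij := eq_or_ne i j
      · simp [hπ _ x hx, hπ _ _ hm]
      · simp [hπ0 _ _ hij x hx, hπ0 (i + k * 2) (j + k * 2) (by simpa using hij) _ hm]
  have htr (Z : Module.End K V) (hZ : Z * f = f * Z) (k : ℕ) :
      LinearMap.trace K V (Z * π (a + k)) = LinearMap.trace K V (Z * π (a - k)) := by
    have hinj : ∀ x ∈ A (a - k), (f ^ k) x = 0 → x = 0 := fun x hx h0 =>
      (Submodule.disjoint_def.1 (hL k).2) x h0 hx
    have hex : ∃ u : Module.End K V, f ^ k * u = π (a + k) ∧ ∀ x, u x ∈ A (a - k) := by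
      let F : A (a - k) →ₗ[K] V := (f ^ k).comp (A (a - k)).subtype
      have hF : LinearMap.ker F = ⊥ := LinearMap.ker_eq_bot'.2 fun x hx =>
        Subtype.ext (hinj x x.2 hx)
      obtain ⟨s, hs⟩ := F.exists_leftInverse_of_injective hF
      refine ⟨(A (a - k)).subtype ∘ₗ s ∘ₗ π (a + k), ?_, fun x => (s _).2⟩
      ext x
      have hx := hπm (a + k) x
      rw [← (hL k).1] at hx
      obtain ⟨y, hy, hyx⟩ := hx
      have h1 : s ((f ^ k) y) = ⟨y, hy⟩ := congr($hs ⟨y, hy⟩)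
      simp [← hyx, h1]
    obtain ⟨u, hu, hum⟩ := hex
    have hu' : u * f ^ k = π (a - k) := by
      ext x
      rw [← sub_eq_zero]
      refine hinj _ (sub_mem (hum _) (hπm _ _)) ?_
      have h1 := hπf (a - k) k
      rw [show a - (k : ℤ) + k * 2 = a + k by ring] at h1
      have h2 : f ^ k * (u * f ^ k) = f ^ k * π (a - k) := by rw [← mul_assoc, hu, h1]
      rw [map_sub, sub_eq_zero]
      exact congr($h2 x)
    have hZk : Z * f ^ k = f ^ k * Z := (show Commute Z f from hZ).pow_right k
    rw [← hu, ← hu', ← mul_assoc, hZk, mul_assoc, LinearMap.trace_mul_comm, mul_assoc,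
      LinearMap.trace_mul_comm]
  have hHtr : ∀ Z : Module.End K V, Z * f = f * Z → LinearMap.trace K V (Z * H) = 0 := by
    intro Z hZ
    have htr' (i : ℤ) :
        LinearMap.trace K V (Z * π i) = LinearMap.trace K V (Z * π (2 * a - i)) := by
      obtain ⟨k, hk⟩ := Int.eq_nat_or_neg (i - a)
      have h1 := htr Z hZ k
      obtain hk | hk := hk
      · obtain rfl : i = a + k := by lia
        rw [h1]; congr 3; ring
      · obtain rfl : i = a - k := by lia
        rw [← h1]; congr 3; ring
    have hfin := WellFoundedGT.finite_ne_bot_of_iSupIndep hA.submodule_iSupIndep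
    let S : Finset ℤ := hfin.toFinset ∪ hfin.toFinset.image (fun i => 2 * a - i)
    have hHS : H = ∑ i ∈ S, ((i - a : ℤ) : K) • π i := by
      refine hA.linearMap_ext fun j x hx => ?_
      by_cases hj : A j = ⊥
      · obtain rfl : x = 0 := by simpa [hj] using hx
        simp
      rw [hH j x hx, LinearMap.sum_apply, Finset.sum_eq_single j]
      · simp [hπ j x hx]
      · intro i _ hij
        simp [hπ0 i j hij x hx]
      · intro h
        exact absurd (by simp [S, hj]) h
    rw [hHS, Finset.mul_sum, map_sum]
    refine Finset.sum_involution (fun i _ => 2 * a - i) ?_ ?_ ?_ ?_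
    · intro i _
      simp only [mul_smul_comm, map_smul, ← htr' i, smul_eq_mul]
      push_cast
      ring
    · intro i _ hi h
      obtain rfl : i = a := by lia
      simp at hi
    · intro i hi
      simp only [S, Finset.mem_union, Finset.mem_image] at hi ⊢
      rcases hi with hi | ⟨j, hj, rfl⟩
      · exact Or.inr ⟨i, hi, rfl⟩
      · left; simpa using hj
    · intro i _
      simp
  obtain ⟨e, he⟩ := LinearMap.exists_commutator_eq f H hHtr
  obtain ⟨e', he'⟩ := hA.exists_linearMap fun i => π (i - 2) * e
  refine ⟨e', fun i x hx => ?_, fun i x hx => ?_⟩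
  · rw [he' i x hx]
    exact hπm _ _
  · rw [he' i x hx, he' _ _ (hf i x hx)]
    have h1 := congr($(hπf (i - 2) 1) (e x))
    have h2 := congr($he x)
    simp only [Nat.cast_one, one_mul, sub_add_cancel, pow_one, Module.End.mul_apply,
      LinearMap.sub_apply, hH i x hx] at h1 h2
    simp only [Module.End.mul_apply, add_sub_cancel_right, h1]
    rw [← map_sub, h2]
    simp [hπ i x hx]

variable {C : ℤ → Submodule K V} {F E : Module.End K V} {w : ℤ}

/-- The commutation relation between `E` and the powers of `F` in an `sl₂`-triple. -/
lemma lowering_apply_raising_pow_succ (hF : ∀ i, ∀ x ∈ C i, F x ∈ C (i + 2))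
    (hFE : ∀ i, ∀ x ∈ C i, F (E x) - E (F x) = ((i - w : ℤ) : K) • x)
    {n : ℤ} {x : V} (hx : x ∈ C n) (j : ℕ) :
    E ((F ^ (j + 1)) x) =
      (F ^ (j + 1)) (E x) - (((j + 1) * (n - w + j) : ℤ) : K) • (F ^ j) x := by
  induction j with
  | zero =>
    have h1 := hFE n x hx
    rw [sub_eq_iff_eq_add', ← sub_eq_iff_eq_add] at h1
    simpa using h1.symm
  | succ j ih =>
    have h1 := hFE _ _ (pow_apply_mem_of_degree hF (j + 1) hx)
    rw [ih] at h1
    rw [pow_succ' F (j + 1), Module.End.mul_apply, Module.End.mul_apply]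
    rw [sub_eq_iff_eq_add', ← sub_eq_iff_eq_add] at h1
    rw [← h1, map_sub, map_smul, ← Module.End.mul_apply F (F ^ j), ← pow_succ', sub_sub,
      ← add_smul]
    congr 2
    push_cast
    ring

/-- In an `sl₂`-triple on a grading bounded below, `F ^ k` is injective in degree `w - k`. -/
lemma raising_pow_injOn [CharZero K] (hF : ∀ i, ∀ x ∈ C i, F x ∈ C (i + 2))
    (hE : ∀ i, ∀ x ∈ C i, E x ∈ C (i - 2))
    (hFE : ∀ i, ∀ x ∈ C i, F (E x) - E (F x) = ((i - w : ℤ) : K) • x)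
    (hbot : {i | C i ≠ ⊥}.Finite) (k : ℕ) {x : V} (hx : x ∈ C (w - k))
    (h0 : (F ^ k) x = 0) : x = 0 := by
  obtain ⟨m, hm⟩ := hbot.bddBelow
  suffices ∀ d k : ℕ, w - m < k + d → ∀ x ∈ C (w - k), (F ^ k) x = 0 → x = 0 from
    this (w - m + 1).toNat k (by lia) x hx h0
  clear! x k
  intro d
  induction d with
  | zero =>
    intro k hk x hx _
    by_contra hne
    have : m ≤ w - k := hm fun hb => hne (by simpa [hb] using hx)
    simp at hk
    lia
  | succ d ih =>
    intro k hk x hx h0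
    have hEx : E x = 0 := by
      refine ih (k + 2) (by push_cast at hk ⊢; lia) (E x) ?_ ?_
      · have := hE _ x hx
        rwa [show w - (k : ℤ) - 2 = w - ((k + 2 : ℕ) : ℤ) by push_cast; ring] at this
      · have h1 := lowering_apply_raising_pow_succ hF hFE hx (k + 1)
        have h2 : (F ^ (k + 1)) x = 0 := by rw [pow_succ', Module.End.mul_apply, h0, map_zero]
        have h3 : (F ^ (k + 1 + 1)) x = 0 := by
          rw [pow_succ', Module.End.mul_apply, h2, map_zero]
        rw [h2, h3] at h1
        simpa using h1.symm
    have hdesc : ∀ i ≤ k, (F ^ (k - i)) x = 0 := by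
      intro i
      induction i with
      | zero => simpa using h0
      | succ i ihi =>
        intro hi
        have h1 := lowering_apply_raising_pow_succ hF hFE hx (k - (i + 1))
        rw [show k - (i + 1) + 1 = k - i by lia, ihi (by lia), hEx] at h1
        simp only [map_zero, zero_sub, zero_eq_neg, smul_eq_zero, Int.cast_eq_zero,
          mul_eq_zero] at h1
        rcases h1 with h1 | h1
        · lia
        · exact h1
    simpa using hdesc k le_rfl

/-- An `sl₂`-triple on a graded space satisfies the hard Lefschetz property. -/
lemma lefschetz_of_lowering [CharZero K] [FiniteDimensional K V] (hC : DirectSum.IsInternal C)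
    (hF : ∀ i, ∀ x ∈ C i, F x ∈ C (i + 2)) (hE : ∀ i, ∀ x ∈ C i, E x ∈ C (i - 2))
    (hFE : ∀ i, ∀ x ∈ C i, F (E x) - E (F x) = ((i - w : ℤ) : K) • x) (k : ℕ) :
    (C (w - k)).map (F ^ k) = C (w + k) ∧ Disjoint (LinearMap.ker (F ^ k)) (C (w - k)) := by
  have hfin := WellFoundedGT.finite_ne_bot_of_iSupIndep hC.submodule_iSupIndep
  have hFi : ∀ x ∈ C (w - k), (F ^ k) x = 0 → x = 0 := fun x hx =>
    raising_pow_injOn hF hE hFE hfin k hx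
  have hEi : ∀ x ∈ C (w + k), (E ^ k) x = 0 → x = 0 := fun x hx => by
    refine raising_pow_injOn (C := fun i => C (-i)) (F := E) (E := F) (w := -w)
      (fun i x hx => ?_) (fun i x hx => ?_) (fun i x hx => ?_) ?_ k ?_
    · rw [neg_add]; exact hE _ _ hx
    · rw [neg_sub']; simpa using hF _ _ hx
    · rw [← neg_sub (F (E x)), hFE _ _ hx, ← neg_smul]
      push_cast
      congr 1
      ring
    · exact hfin.preimage neg_injective.injOn
    · convert hx using 2
      ring
  have hle : (C (w - k)).map (F ^ k) ≤ C (w + k) := by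
    rintro _ ⟨x, hx, rfl⟩
    have := pow_apply_mem_of_degree hF k hx
    rwa [show w - (k : ℤ) + k * 2 = w + k by ring] at this
  have hle' : (C (w + k)).map (E ^ k) ≤ C (w - k) := by
    rintro _ ⟨x, hx, rfl⟩
    have := pow_apply_mem_of_degree (d := -2) hE k hx
    rwa [show w + (k : ℤ) + k * -2 = w - k by ring] at this
  have hrank {p : Submodule K V} {G : Module.End K V} (h : ∀ x ∈ p, G x = 0 → x = 0) :
      Module.finrank K (p.map G) = Module.finrank K p := by
    rw [← LinearMap.range_domRestrict]
    exact LinearMap.finrank_range_of_inj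
      ((injective_iff_map_eq_zero _).2 fun x hx => Subtype.ext (h x x.2 hx))
  refine ⟨Submodule.eq_of_le_of_finrank_le hle ?_,
    Submodule.disjoint_def.2 fun x h0 hx => hFi x hx h0⟩
  rw [hrank hFi, ← hrank hEi]
  exact Submodule.finrank_mono hle'

end Lefschetz

section TensorGrading

variable {K V W : Type*} [Field K] [AddCommGroup V] [Module K V] [AddCommGroup W] [Module K W]
  {A : ℤ → Submodule K V} {B : ℤ → Submodule K W} {C : ℤ → Submodule K (V ⊗[K] W)}

/-- To bound a graded piece of a tensor product by a submodule, it suffices to look at pure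
tensors of homogeneous elements. -/
lemma tensorGrading_le
    (hC : ∀ n : ℤ, C n = ⨆ p : ℤ × ℤ, ⨆ _ : p.1 + p.2 = n,
      LinearMap.range (TensorProduct.map (A p.1).subtype (B p.2).subtype))
    {n : ℤ} {N : Submodule K (V ⊗[K] W)}
    (h : ∀ i j, i + j = n → ∀ x ∈ A i, ∀ y ∈ B j, x ⊗ₜ[K] y ∈ N) : C n ≤ N := by
  rw [hC]
  refine iSup₂_le fun p hp => ?_
  rintro _ ⟨t, rfl⟩
  induction t with
  | zero => simp
  | tmul x y => exact h _ _ hp x x.2 y y.2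
  | add s t hs ht => rw [map_add]; exact add_mem hs ht

lemma tmul_mem_tensorGrading
    (hC : ∀ n : ℤ, C n = ⨆ p : ℤ × ℤ, ⨆ _ : p.1 + p.2 = n,
      LinearMap.range (TensorProduct.map (A p.1).subtype (B p.2).subtype))
    {i j n : ℤ} (hn : i + j = n) {x : V} (hx : x ∈ A i) {y : W} (hy : y ∈ B j) :
    x ⊗ₜ[K] y ∈ C n := by
  rw [hC]
  exact le_iSup₂_of_le (f := fun (p : ℤ × ℤ) (_ : p.1 + p.2 = n) =>
    LinearMap.range (TensorProduct.map (A p.1).subtype (B p.2).subtype)) (i, j) hn le_rfl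
    ⟨⟨x, hx⟩ ⊗ₜ ⟨y, hy⟩, by simp⟩

/-- The total grading on a tensor product of internally graded spaces is internal. -/
lemma isInternal_tensorGrading [CharZero K] (hA : DirectSum.IsInternal A)
    (hB : DirectSum.IsInternal B)
    (hC : ∀ n : ℤ, C n = ⨆ p : ℤ × ℤ, ⨆ _ : p.1 + p.2 = n,
      LinearMap.range (TensorProduct.map (A p.1).subtype (B p.2).subtype)) :
    DirectSum.IsInternal C := by
  rw [DirectSum.isInternal_submodule_iff_iSupIndep_and_iSup_eq_top]
  constructor
  · obtain ⟨D, hD⟩ := hA.exists_linearMap fun i => (i : K) • (LinearMap.id : V →ₗ[K] V)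
    obtain ⟨D', hD'⟩ := hB.exists_linearMap fun i => (i : K) • (LinearMap.id : W →ₗ[K] W)
    let T : Module.End K (V ⊗[K] W) := D.rTensor W + D'.lTensor V
    refine ((Module.End.eigenspaces_iSupIndep T).comp
      (Int.cast_injective (α := K))).mono fun n => tensorGrading_le hC fun i j hn x hx y hy => ?_
    simp only [Function.comp_apply, Module.End.mem_eigenspace_iff]
    simp [T, hD i x hx, hD' j y hy, ← hn, TensorProduct.smul_tmul', add_smul]
  · rw [eq_top_iff, ← TensorProduct.span_tmul_eq_top, Submodule.span_le]
    rintro _ ⟨x, y, rfl⟩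
    have hx : x ∈ ⨆ i, A i := by rw [hA.submodule_iSup_eq_top]; trivial
    have hy : y ∈ ⨆ i, B i := by rw [hB.submodule_iSup_eq_top]; trivial
    simp only [SetLike.mem_coe]
    induction hx using Submodule.iSup_induction' with
    | zero => simp
    | add x x' _ _ h h' => rw [TensorProduct.add_tmul]; exact add_mem h h'
    | mem i x hx =>
      induction hy using Submodule.iSup_induction' with
      | zero => simp
      | add y y' _ _ h h' => rw [TensorProduct.tmul_add]; exact add_mem h h'
      | mem j y hy => exact Submodule.mem_iSup_of_mem (i + j) (tmul_mem_tensorGrading hC rfl hx hy)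

end TensorGrading



/-- Let `(A, f)` be a graded Lefschetz structure of weight `a` and `(B, g)`
one of weight `b` over a field `K` of characteristic zero.  Here a graded Lefschetz structure
of weight `a` on a finite-dimensional `K`-vector space is an internal `ℤ`-grading by
submodules together with a degree-2 endomorphism `f` such that `f^k : A_{a−k} → A_{a+k}` is
an isomorphism for all `k ≥ 0` (expressed below as: `f^k` maps `A_{a−k}` onto `A_{a+k}` and
`ker (f^k)` meets `A_{a−k}` trivially).  Equip `A ⊗ B` with the grading
`(A ⊗ B)_n = ⊕_{i+j=n} A_i ⊗ B_j` and the degree-2 operator `h = f ⊗ 1 + 1 ⊗ g`.  Then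
`(A ⊗ B, h)` is a graded Lefschetz structure of weight `a + b`: the pieces form an internal
grading, `h` has degree 2, and for every `k ≥ 0` the map
`h^k : (A ⊗ B)_{a+b−k} → (A ⊗ B)_{a+b+k}` is an isomorphism. -/
theorem gradedLefschetz_tensorProduct
    (K V₁ V₂ : Type*) [Field K] [CharZero K]
    [AddCommGroup V₁] [Module K V₁] [FiniteDimensional K V₁]
    [AddCommGroup V₂] [Module K V₂] [FiniteDimensional K V₂]
    (A : ℤ → Submodule K V₁) (B : ℤ → Submodule K V₂)
    (hA : DirectSum.IsInternal A) (hB : DirectSum.IsInternal B)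
    (f : V₁ →ₗ[K] V₁) (g : V₂ →ₗ[K] V₂)
    (hf2 : ∀ i, (A i).map f ≤ A (i + 2)) (hg2 : ∀ i, (B i).map g ≤ B (i + 2))
    (a b : ℤ)
    (hfL : ∀ k : ℕ, (A (a - k)).map (f ^ k) = A (a + k) ∧
      Disjoint (LinearMap.ker (f ^ k)) (A (a - k)))
    (hgL : ∀ k : ℕ, (B (b - k)).map (g ^ k) = B (b + k) ∧
      Disjoint (LinearMap.ker (g ^ k)) (B (b - k)))
    (C : ℤ → Submodule K (V₁ ⊗[K] V₂))
    (hC : ∀ n : ℤ, C n = ⨆ p : ℤ × ℤ, ⨆ _ : p.1 + p.2 = n,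
      LinearMap.range (TensorProduct.map (A p.1).subtype (B p.2).subtype))
    (h : V₁ ⊗[K] V₂ →ₗ[K] V₁ ⊗[K] V₂)
    (hh : h = TensorProduct.map f LinearMap.id + TensorProduct.map LinearMap.id g) :
    DirectSum.IsInternal C ∧
    (∀ n : ℤ, (C n).map h ≤ C (n + 2)) ∧
    (∀ k : ℕ, (C (a + b - k)).map (h ^ k) = C (a + b + k) ∧
      Disjoint (LinearMap.ker (h ^ k)) (C (a + b - k))) := by
  have hf2' : ∀ i, ∀ x ∈ A i, f x ∈ A (i + 2) := fun i x hx => hf2 i ⟨x, hx, rfl⟩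
  have hg2' : ∀ i, ∀ x ∈ B i, g x ∈ B (i + 2) := fun i x hx => hg2 i ⟨x, hx, rfl⟩
  obtain ⟨e, he2, hfe⟩ := exists_lowering_of_lefschetz hA hf2' hfL
  obtain ⟨e', he2', hge⟩ := exists_lowering_of_lefschetz hB hg2' hgL
  have hint := isInternal_tensorGrading hA hB hC
  let E : Module.End K (V₁ ⊗[K] V₂) :=
    TensorProduct.map e LinearMap.id + TensorProduct.map LinearMap.id e'
  have hh2 (n : ℤ) : C n ≤ (C (n + 2)).comap h :=
    tensorGrading_le hC fun i j hn x hx y hy => by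
      rw [Submodule.mem_comap, hh]
      exact add_mem (tmul_mem_tensorGrading hC (by lia) (hf2' i x hx) hy)
        (tmul_mem_tensorGrading hC (by lia) hx (hg2' j y hy))
  have hE2 (n : ℤ) : C n ≤ (C (n - 2)).comap E :=
    tensorGrading_le hC fun i j hn x hx y hy =>
      add_mem (tmul_mem_tensorGrading hC (by lia) (he2 i x hx) hy)
        (tmul_mem_tensorGrading hC (by lia) hx (he2' j y hy))
  have hhE (n : ℤ) : C n ≤ Module.End.eigenspace (h * E - E * h) ((n - (a + b) : ℤ) : K) :=
    tensorGrading_le hC fun i j hn x hx y hy => by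
      rw [Module.End.mem_eigenspace_iff]
      have h1 : (h * E - E * h) (x ⊗ₜ y) =
          (f (e x) - e (f x)) ⊗ₜ y + x ⊗ₜ (g (e' y) - e' (g y)) := by
        simp [hh, E, TensorProduct.sub_tmul, TensorProduct.tmul_sub]
        abel
      rw [h1, hfe i x hx, hge j y hy, ← hn, TensorProduct.tmul_smul, ← TensorProduct.smul_tmul',
        ← add_smul]
      congr 1
      push_cast
      ring
  exact ⟨hint, fun n => Submodule.map_le_iff_le_comap.2 (hh2 n), lefschetz_of_lowering hint hh2 hE2
    fun n x hx => Module.End.mem_eigenspace_iff.1 (hhE n hx)⟩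
end

section
/- Let K be a field of characteristic zero. Let (H, a) be a graded Lefschetz structure of weight R with R ≥ 1, concentrated in degrees 0 through 2R, and with H_0 ≠ 0. Let W be a K-vector space of dimension 2g, let ξ ∈ ⋀²W, and let μ ∈ K. Equip V = H ⊗ ⋀W with the grading V_n = ⊕_{i+j=n} H_i ⊗ ⋀^j W and the degree-2 operator L = μ(a ⊗ 1) + 1 ⊗ (ξ ∧ −). Then L^k : V_{R+g−k} → V_{R+g+k} is an isomorphism for every k ≥ 0 if and only if μ ≠ 0 and ξ^g ≠ 0 in ⋀^{2g}W. -/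
open TensorProduct ExteriorAlgebra

theorem Submodule.finrank_map_of_disjoint_ker {K M N : Type*} [Field K] [AddCommGroup M]
    [Module K M] [AddCommGroup N] [Module K N] {f : M →ₗ[K] N} {p : Submodule K M}
    (h : Disjoint (LinearMap.ker f) p) : Module.finrank K (p.map f) = Module.finrank K p := by
  rw [← LinearMap.range_domRestrict]
  refine LinearMap.finrank_range_of_inj (LinearMap.ker_eq_bot.1 (LinearMap.ker_eq_bot'.2 ?_))
  exact fun x hx => Subtype.ext (Submodule.disjoint_def.1 h x hx x.2)

section GradedMaps

variable {ι K M N : Type*} [DecidableEq ι] [Field K] [AddCommGroup M] [Module K M]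
  [AddCommGroup N] [Module K N] {A : ι → Submodule K M}

/-- Linear maps on the pieces of an internal direct sum glue to a linear map on the sum. -/
theorem DirectSum.IsInternal.exists_linearMap_s4 (hA : DirectSum.IsInternal A)
    (f : ∀ i, A i →ₗ[K] N) : ∃ F : M →ₗ[K] N, ∀ i (x : A i), F x = f i x := by
  let e := LinearEquiv.ofBijective (DirectSum.coeLinearMap A) hA
  refine ⟨DirectSum.toModule K ι N f ∘ₗ e.symm.toLinearMap, fun i x => ?_⟩
  have : e.symm (x : M) = DirectSum.lof K ι (fun i => A i) i x := by
    rw [LinearEquiv.symm_apply_eq]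
    exact (DirectSum.coeLinearMap_lof A i x).symm
  simp [this]

/-- If each `B i` has dimension at most that of the graded piece `A i`, then a single linear map
sends every `A i` onto a subspace containing `B i`. -/
theorem DirectSum.IsInternal.exists_le_map [FiniteDimensional K M] [FiniteDimensional K N]
    (hA : DirectSum.IsInternal A) (B : ι → Submodule K N)
    (h : ∀ i, Module.finrank K (B i) ≤ Module.finrank K (A i)) :
    ∃ F : M →ₗ[K] N, ∀ i, B i ≤ (A i).map F := by
  have hs : ∀ i, ∃ f : A i →ₗ[K] B i, Function.Surjective f := fun i => by
    obtain ⟨v, hv⟩ := finrank_le_iff_exists_linearMap.1 (h i)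
    obtain ⟨u, hu⟩ := v.exists_leftInverse_of_injective (LinearMap.ker_eq_bot.2 hv)
    exact ⟨u, fun y => ⟨_, LinearMap.congr_fun hu y⟩⟩
  choose f hf using hs
  obtain ⟨F, hF⟩ := hA.exists_linearMap_s4 fun i => (B i).subtype ∘ₗ f i
  refine ⟨F, fun i y hy => ?_⟩
  obtain ⟨x, hx⟩ := hf i ⟨y, hy⟩
  exact ⟨x, x.2, by simp [hF, hx]⟩

end GradedMaps

section TensorGrading

variable {K M N : Type*} [Field K] [AddCommGroup M] [Module K M] [AddCommGroup N] [Module K N]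
  {A : ℤ → Submodule K M} {B : ℤ → Submodule K N}

/-- The degree `n` part of the tensor product of two `ℤ`-graded vector spaces. -/
def tensorGrading (A : ℤ → Submodule K M) (B : ℤ → Submodule K N) (n : ℤ) :
    Submodule K (M ⊗[K] N) :=
  ⨆ p : ℤ × ℤ, ⨆ _ : p.1 + p.2 = n,
    LinearMap.range (TensorProduct.map (A p.1).subtype (B p.2).subtype)

theorem tmul_mem_tensorGrading_s4 {i j n : ℤ} (h : i + j = n) {x : M} (hx : x ∈ A i) {y : N}
    (hy : y ∈ B j) : x ⊗ₜ y ∈ tensorGrading A B n :=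
  (le_iSup₂_of_le (f := fun (p : ℤ × ℤ) (_ : p.1 + p.2 = n) =>
    LinearMap.range (TensorProduct.map (A p.1).subtype (B p.2).subtype)) (i, j) h le_rfl)
    ⟨⟨x, hx⟩ ⊗ₜ ⟨y, hy⟩, by simp⟩

theorem tensorGrading_le_s4 {n : ℤ} {S : Submodule K (M ⊗[K] N)}
    (h : ∀ i j, i + j = n → ∀ x ∈ A i, ∀ y ∈ B j, x ⊗ₜ y ∈ S) : tensorGrading A B n ≤ S := by
  refine iSup₂_le fun p hp => ?_
  rintro _ ⟨z, rfl⟩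
  induction z with
  | zero => simp
  | tmul x y => exact h _ _ hp _ x.2 _ y.2
  | add a b ha hb => rw [map_add]; exact S.add_mem ha hb

theorem tensorGrading_eq_bot {n : ℤ} (hA : ∀ i < 0, A i = ⊥) (hB : ∀ i < 0, B i = ⊥)
    (hn : n < 0) : tensorGrading A B n = ⊥ := by
  refine eq_bot_iff.2 (tensorGrading_le_s4 fun i j hij x hx y hy => ?_)
  rcases lt_or_ge i 0 with hi | hi
  · rw [hA i hi, Submodule.mem_bot] at hx
    simp [hx]
  · rw [hB j (by omega), Submodule.mem_bot] at hy
    simp [hy]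

theorem tensorGrading_le_map {s t : ℤ} {F : M →ₗ[K] M} {G : N →ₗ[K] N}
    (hF : ∀ i, A (s - i) ≤ (A i).map F) (hG : ∀ j, B (t - j) ≤ (B j).map G) (n : ℤ) :
    tensorGrading A B (s + t - n) ≤ (tensorGrading A B n).map (TensorProduct.map F G) := by
  refine tensorGrading_le_s4 fun i j hij x hx y hy => ?_
  obtain ⟨x', hx', rfl⟩ := hF (s - i) (by simpa using hx)
  obtain ⟨y', hy', rfl⟩ := hG (t - j) (by simpa using hy)
  exact ⟨x' ⊗ₜ y', tmul_mem_tensorGrading_s4 (by omega) hx' hy', by simp⟩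

theorem map_pow_tensorGrading_le {L : M ⊗[K] N →ₗ[K] M ⊗[K] N} {d : ℤ}
    (hL : ∀ n, (tensorGrading A B n).map L ≤ tensorGrading A B (n + d)) (k : ℕ) (n : ℤ) :
    (tensorGrading A B n).map (L ^ k) ≤ tensorGrading A B (n + k * d) := by
  induction k with
  | zero => simp [Module.End.one_eq_id]
  | succ k ih =>
    rw [pow_succ', Module.End.mul_eq_comp, Submodule.map_comp]
    refine (Submodule.map_mono ih).trans ((hL _).trans (le_of_eq ?_))
    congr 1
    push_cast
    ring

end TensorGrading

namespace ExteriorAlgebra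

variable {K W : Type*} [Field K] [AddCommGroup W] [Module K W]

variable (K W) in
/-- The exterior powers as a `ℤ`-indexed family, zero in negative degrees. -/
def intGrading (j : ℤ) : Submodule K (ExteriorAlgebra K W) :=
  if 0 ≤ j then ⋀[K]^(j.toNat) W else ⊥

@[simp]
theorem intGrading_natCast (j : ℕ) : intGrading K W j = ⋀[K]^j W := by
  simp [intGrading]

theorem intGrading_of_neg {j : ℤ} (hj : j < 0) : intGrading K W j = ⊥ := by
  simp [intGrading, hj]

theorem isInternal_exteriorPower : DirectSum.IsInternal fun j : ℕ => ⋀[K]^j W :=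
  DirectSum.Decomposition.isInternal _

theorem exteriorPower_eq_bot [FiniteDimensional K W] {j : ℕ} (hj : Module.finrank K W < j) :
    ⋀[K]^j W = ⊥ := by
  rw [← Submodule.finrank_eq_zero (R := K), exteriorPower.finrank_eq, Nat.choose_eq_zero_of_lt hj]

instance [FiniteDimensional K W] : FiniteDimensional K (ExteriorAlgebra K W) :=
  Module.Finite.of_basis (Module.finBasis K W).ExteriorAlgebra

theorem intGrading_of_gt [FiniteDimensional K W] {j : ℤ} (hj : Module.finrank K W < j) :
    intGrading K W j = ⊥ := by
  lift j to ℕ using by omega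
  rw [intGrading_natCast, exteriorPower_eq_bot (by exact_mod_cast hj)]

theorem exists_intGrading_le_map [FiniteDimensional K W] :
    ∃ F : ExteriorAlgebra K W →ₗ[K] ExteriorAlgebra K W, ∀ j,
      intGrading K W (Module.finrank K W - j) ≤ (intGrading K W j).map F := by
  obtain ⟨F, hF⟩ := (isInternal_exteriorPower (K := K) (W := W)).exists_le_map
    (fun j => intGrading K W (Module.finrank K W - j)) fun j => by
      rcases le_or_gt j (Module.finrank K W) with hj | hj
      · rw [← Nat.cast_sub hj, intGrading_natCast, exteriorPower.finrank_eq,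
          exteriorPower.finrank_eq, Nat.choose_symm hj]
      · rw [intGrading_of_neg (by omega)]
        simp
  refine ⟨F, fun j => ?_⟩
  rcases lt_or_ge j 0 with hj | hj
  · rw [intGrading_of_gt (by omega)]
    exact bot_le
  · lift j to ℕ using hj
    simpa using hF j

theorem pow_mem_exteriorPower {ξ : ExteriorAlgebra K W} (hξ : ξ ∈ ⋀[K]^2 W) (k : ℕ) :
    ξ ^ k ∈ ⋀[K]^(2 * k) W := by
  rw [exteriorPower, pow_mul]
  exact Submodule.pow_mem_pow _ hξ k

theorem ι_mul_mem {j : ℕ} (w : W) {x : ExteriorAlgebra K W} (hx : x ∈ ⋀[K]^j W) :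
    ι K w * x ∈ ⋀[K]^(j + 1) W := by
  rw [exteriorPower, pow_succ']
  exact Submodule.mul_mem_mul ⟨w, rfl⟩ hx

theorem linearMap_ext_exteriorPower {N : Type*} [AddCommGroup N] [Module K N]
    {F G : ExteriorAlgebra K W →ₗ[K] N} (h : ∀ j : ℕ, ∀ x ∈ ⋀[K]^j W, F x = G x) : F = G := by
  refine LinearMap.ext fun x => ?_
  induction x using DirectSum.Decomposition.inductionOn fun i => ⋀[K]^i W with
  | zero => simp
  | homogeneous m => exact h _ _ m.2
  | add a b ha hb => rw [map_add, map_add, ha, hb]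

/-- Contraction of the exterior algebra by a covector. -/
noncomputable abbrev contract (φ : Module.Dual K W) :
    ExteriorAlgebra K W →ₗ[K] ExteriorAlgebra K W :=
  CliffordAlgebra.contractLeft (Q := (0 : QuadraticForm K W)) φ

theorem contract_ι_mul (φ : Module.Dual K W) (w : W) (x : ExteriorAlgebra K W) :
    contract φ (ι K w * x) = φ w • x - ι K w * contract φ x :=
  CliffordAlgebra.contractLeft_ι_mul (Q := (0 : QuadraticForm K W)) (d := φ) w x

theorem contract_mem (φ : Module.Dual K W) {j : ℕ} {x : ExteriorAlgebra K W}
    (hx : x ∈ ⋀[K]^(j + 1) W) : contract φ x ∈ ⋀[K]^j W := by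
  induction j generalizing x with
  | zero =>
    rw [exteriorPower, zero_add, pow_one] at hx
    obtain ⟨w, rfl⟩ := hx
    rw [exteriorPower, pow_zero]
    have : contract φ (ι K w) = algebraMap K (ExteriorAlgebra K W) (φ w) :=
      CliffordAlgebra.contractLeft_ι (Q := (0 : QuadraticForm K W)) φ w
    rw [this]
    exact Submodule.algebraMap_mem _
  | succ j ih =>
    rw [exteriorPower, pow_succ'] at hx
    induction hx using Submodule.mul_induction_on' with
    | mem_mul_mem a ha b hb =>
      obtain ⟨w, rfl⟩ := ha
      rw [contract_ι_mul]
      exact Submodule.sub_mem _ (Submodule.smul_mem _ _ hb) (ι_mul_mem w (ih hb))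
    | add a _ b _ ha hb => rw [map_add]; exact Submodule.add_mem _ ha hb

theorem contract_mem_intGrading (φ : Module.Dual K W) {j : ℤ} {x : ExteriorAlgebra K W}
    (hx : x ∈ intGrading K W j) : contract φ x ∈ intGrading K W (j - 1) := by
  rcases lt_trichotomy j 0 with hj | rfl | hj
  · rw [intGrading_of_neg hj, Submodule.mem_bot] at hx
    simp [hx]
  · rw [← Nat.cast_zero, intGrading_natCast, exteriorPower, pow_zero, Submodule.mem_one] at hx
    obtain ⟨c, rfl⟩ := hx
    have : contract φ (algebraMap K (ExteriorAlgebra K W) c) = 0 :=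
      CliffordAlgebra.contractLeft_algebraMap (Q := (0 : QuadraticForm K W)) φ c
    rw [this]
    exact Submodule.zero_mem _
  · obtain ⟨n, rfl⟩ : ∃ n : ℕ, j = (n + 1 : ℕ) := ⟨(j - 1).toNat, by omega⟩
    rw [intGrading_natCast] at hx
    rw [show (((n + 1 : ℕ) : ℤ) - 1) = n by push_cast; ring, intGrading_natCast]
    exact contract_mem φ hx

theorem ι_mul_comm (v w : W) : ι K v * ι K w = -(ι K w * ι K v) :=
  eq_neg_of_add_eq_zero_left (ι_add_mul_swap v w)

theorem commute_ι_of_mem_two {ξ : ExteriorAlgebra K W} (hξ : ξ ∈ ⋀[K]^2 W) (w : W) :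
    Commute ξ (ι K w) := by
  rw [exteriorPower, pow_two] at hξ
  induction hξ using Submodule.mul_induction_on' with
  | mem_mul_mem a ha b hb =>
    obtain ⟨u, rfl⟩ := ha
    obtain ⟨v, rfl⟩ := hb
    change _ = _
    rw [mul_assoc, ι_mul_comm v w, mul_neg, ← mul_assoc, ι_mul_comm u w, neg_mul, neg_neg,
      mul_assoc]
  | add a _ b _ ha hb => exact ha.add_left hb

theorem contract_mul_of_mem_two (φ : Module.Dual K W) {ξ : ExteriorAlgebra K W}
    (hξ : ξ ∈ ⋀[K]^2 W) (x : ExteriorAlgebra K W) :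
    contract φ (ξ * x) = contract φ ξ * x + ξ * contract φ x := by
  rw [exteriorPower, pow_two] at hξ
  induction hξ using Submodule.mul_induction_on' with
  | mem_mul_mem a ha b hb =>
    obtain ⟨u, rfl⟩ := ha
    obtain ⟨v, rfl⟩ := hb
    have hv : contract φ (ι K v) = algebraMap K (ExteriorAlgebra K W) (φ v) :=
      CliffordAlgebra.contractLeft_ι (Q := (0 : QuadraticForm K W)) φ v
    rw [mul_assoc, contract_ι_mul, contract_ι_mul, contract_ι_mul, hv]
    simp only [Algebra.algebraMap_eq_smul_one, mul_sub, sub_mul, smul_mul_assoc, mul_smul_comm,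
      mul_one, mul_assoc]
    abel
  | add a _ b _ ha hb =>
    rw [add_mul, map_add, map_add, ha, hb]
    noncomm_ring

theorem exists_contract_eq_ι (φ : Module.Dual K W) {ξ : ExteriorAlgebra K W}
    (hξ : ξ ∈ ⋀[K]^2 W) : ∃ w, contract φ ξ = ι K w := by
  have h := contract_mem φ (j := 1) hξ
  rw [exteriorPower, pow_one] at h
  obtain ⟨w, hw⟩ := h
  exact ⟨w, hw.symm⟩

/-- Euler's identity: `∑ eᵢ ∧ (eᵢ* ⌟ x) = j x` for `x` of degree `j`. -/
theorem sum_ι_mul_contract {I : Type*} [Fintype I] (b : Module.Basis I K W) {j : ℕ}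
    {x : ExteriorAlgebra K W} (hx : x ∈ ⋀[K]^j W) :
    ∑ i, ι K (b i) * contract (b.coord i) x = (j : K) • x := by
  induction hx using Submodule.pow_induction_on_left' with
  | algebraMap r =>
    have h (φ : Module.Dual K W) : contract φ (algebraMap K (ExteriorAlgebra K W) r) = 0 :=
      CliffordAlgebra.contractLeft_algebraMap (Q := (0 : QuadraticForm K W)) φ r
    simp [h]
  | add x y j _ _ hx hy => simp only [map_add, mul_add, Finset.sum_add_distrib, hx, hy, smul_add]
  | mem_mul m hm j x _ ih =>
    obtain ⟨w, rfl⟩ := hm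
    have h (i : I) : ι K (b i) * contract (b.coord i) (ι K w * x) =
        ι K (b.repr w i • b i) * x + ι K w * (ι K (b i) * contract (b.coord i) x) := by
      rw [contract_ι_mul, mul_sub, ← mul_assoc, ι_mul_comm (b i) w, neg_mul, sub_neg_eq_add,
        map_smul, smul_mul_assoc, mul_smul_comm, mul_assoc]
      rfl
    rw [Finset.sum_congr rfl fun i _ => h i, Finset.sum_add_distrib, ← Finset.sum_mul,
      ← Finset.mul_sum, ih, ← map_sum, b.sum_repr, mul_smul_comm, Nat.cast_succ, add_smul,
      one_smul, add_comm]

/-- In characteristic zero, an element of `M ⊗ ⋀W` killed by all contractions lies in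
`M ⊗ ⋀⁰W`; this gives the corresponding statement in each degree. -/
theorem exists_tmul_one_of_contract_eq_zero [CharZero K] [FiniteDimensional K W]
    {M : Type*} [AddCommGroup M] [Module K M] {A : ℤ → Submodule K M} {n : ℤ}
    {x : M ⊗[K] ExteriorAlgebra K W} (hx : x ∈ tensorGrading A (intGrading K W) n)
    (h : ∀ φ : Module.Dual K W, (contract φ).lTensor M x = 0) :
    ∃ m ∈ A n, x = m ⊗ₜ 1 := by
  let b := Module.finBasis K W
  let N : ExteriorAlgebra K W →ₗ[K] ExteriorAlgebra K W :=
    ∑ i, LinearMap.mulLeft K (ι K (b i)) ∘ₗ contract (b.coord i)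
  let P : ExteriorAlgebra K W →ₗ[K] ExteriorAlgebra K W :=
    Algebra.linearMap K _ ∘ₗ (algebraMapInv (R := K) (M := W)).toLinearMap
  have hN {j : ℕ} {y : ExteriorAlgebra K W} (hy : y ∈ ⋀[K]^j W) : N y = (j : K) • y := by
    simpa [N] using sum_ι_mul_contract b hy
  have hP {j : ℕ} {y : ExteriorAlgebra K W} (hy : y ∈ ⋀[K]^(j + 1) W) : P y = 0 := by
    rw [exteriorPower, pow_succ'] at hy
    induction hy using Submodule.mul_induction_on' with
    | mem_mul_mem a ha b hb =>
      obtain ⟨w, rfl⟩ := ha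
      simp [P, algebraMapInv]
    | add a _ b _ ha hb => rw [map_add, ha, hb, add_zero]
  obtain ⟨Q, hQ⟩ := (isInternal_exteriorPower (K := K) (W := W)).exists_linearMap_s4
    fun j => (j : K)⁻¹ • (⋀[K]^j W).subtype
  have hQN : Q ∘ₗ N + P = LinearMap.id := by
    refine linearMap_ext_exteriorPower fun j y hy => ?_
    have hQy := hQ j ⟨y, hy⟩
    rw [LinearMap.add_apply, LinearMap.comp_apply, hN hy, map_smul, hQy]
    rcases j with _ | j
    · rw [exteriorPower, pow_zero, Submodule.mem_one] at hy
      obtain ⟨c, rfl⟩ := hy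
      simp [P, algebraMapInv]
    · rw [hP hy]
      have : ((j + 1 : ℕ) : K) ≠ 0 := Nat.cast_ne_zero.2 j.succ_ne_zero
      simp only [LinearMap.smul_apply, Submodule.subtype_apply, add_zero, LinearMap.id_apply]
      rw [smul_inv_smul₀ this]
  have hNx : N.lTensor M x = 0 := by
    have : N.lTensor M = ∑ i, (LinearMap.mulLeft K (ι K (b i))).lTensor M ∘ₗ
        (contract (b.coord i)).lTensor M := by
      simp only [N, ← LinearMap.lTensor_comp]
      exact map_sum (LinearMap.lTensorHom (R := K) M) _ _
    simp [this, h]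
  have hPx : P.lTensor M x = x := by
    have := LinearMap.congr_fun (congrArg (LinearMap.lTensor M) hQN) x
    simpa [LinearMap.lTensor_add, LinearMap.lTensor_comp, hNx] using this
  have hmem : (tensorGrading A (intGrading K W) n).map (P.lTensor M) ≤
      (A n).map ((TensorProduct.mk K M (ExteriorAlgebra K W)).flip 1) := by
    refine Submodule.map_le_iff_le_comap.2 (tensorGrading_le_s4 fun i j hij m hm y hy => ?_)
    rcases lt_or_ge j 0 with hj | hj
    · rw [intGrading_of_neg hj, Submodule.mem_bot] at hy
      simp [hy]
    lift j to ℕ using hj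
    rw [intGrading_natCast] at hy
    rw [Submodule.mem_comap, LinearMap.lTensor_tmul]
    rcases j with _ | j
    · refine ⟨algebraMapInv y • m, (A n).smul_mem _ (by simpa [← hij] using hm), ?_⟩
      simp [P, Algebra.algebraMap_eq_smul_one]
    · rw [hP hy, TensorProduct.tmul_zero]
      exact Submodule.zero_mem _
  obtain ⟨m, hm, hmx⟩ := hmem ⟨x, hx, hPx⟩
  exact ⟨m, hm, hmx.symm⟩

/-- Distinct powers of a degree two element are separated by linear functionals. -/
theorem exists_functional_pow {ξ : ExteriorAlgebra K W} (hξ : ξ ∈ ⋀[K]^2 W) {g : ℕ}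
    (hg : ξ ^ g ≠ 0) : ∃ l : ExteriorAlgebra K W →ₗ[K] K,
      l (ξ ^ g) = 1 ∧ ∀ i, i ≠ g → l (ξ ^ i) = 0 := by
  have hg' : (⟨ξ ^ g, pow_mem_exteriorPower hξ g⟩ : ⋀[K]^(2 * g) W) ≠ 0 := by
    simpa using hg
  obtain ⟨l, hl⟩ := Module.Projective.exists_dual_ne_zero K hg'
  obtain ⟨F, hF⟩ := (isInternal_exteriorPower (K := K) (W := W)).exists_linearMap_s4
    fun j => if h : j = 2 * g then (l ⟨ξ ^ g, pow_mem_exteriorPower hξ g⟩)⁻¹ •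
      (h ▸ l : ⋀[K]^j W →ₗ[K] K) else 0
  refine ⟨F, ?_, fun i hi => ?_⟩
  · have := hF _ ⟨ξ ^ g, pow_mem_exteriorPower hξ g⟩
    simpa [hl] using this
  · have := hF _ ⟨ξ ^ i, pow_mem_exteriorPower hξ i⟩
    rwa [dif_neg (by omega)] at this

end ExteriorAlgebra

section LefschetzOperator

variable {K M W : Type*} [Field K] [AddCommGroup M] [Module K M] [AddCommGroup W] [Module K W]

/-- The operator `μ (a ⊗ 1) + 1 ⊗ (ξ ∧ −)` on `M ⊗ ⋀W`. -/
noncomputable def lefschetzOp (μ : K) (a : M →ₗ[K] M) (ξ : ExteriorAlgebra K W) :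
    Module.End K (M ⊗[K] ExteriorAlgebra K W) :=
  μ • TensorProduct.map a LinearMap.id + TensorProduct.map LinearMap.id (LinearMap.mulLeft K ξ)

@[simp]
theorem lefschetzOp_tmul (μ : K) (a : M →ₗ[K] M) (ξ : ExteriorAlgebra K W) (m : M)
    (y : ExteriorAlgebra K W) :
    lefschetzOp μ a ξ (m ⊗ₜ y) = μ • (a m ⊗ₜ y) + m ⊗ₜ (ξ * y) := by
  simp [lefschetzOp]

theorem lefschetzOp_pow_tmul_one (μ : K) (a : M →ₗ[K] M) (ξ : ExteriorAlgebra K W) (k : ℕ)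
    (m : M) : (lefschetzOp μ a ξ ^ k) (m ⊗ₜ 1) =
      ∑ i ∈ Finset.range (k + 1), ((k.choose i : K) * μ ^ i) • ((a ^ i) m ⊗ₜ[K] (ξ ^ (k - i))) := by
  have hc : Commute (μ • TensorProduct.map a LinearMap.id :
      Module.End K (M ⊗[K] ExteriorAlgebra K W))
      (TensorProduct.map LinearMap.id (LinearMap.mulLeft K ξ)) := by
    refine Commute.smul_left ?_ μ
    exact TensorProduct.ext' fun m y => by simp
  rw [lefschetzOp, hc.add_pow, LinearMap.sum_apply]
  refine Finset.sum_congr rfl fun i hi => ?_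
  clear hi
  have h1 (j : ℕ) (y : ExteriorAlgebra K W) :
      ((TensorProduct.map LinearMap.id (LinearMap.mulLeft K ξ)) ^ j) (m ⊗ₜ y) =
        m ⊗ₜ (ξ ^ j * y) := by
    induction j with
    | zero => simp
    | succ j ih => rw [pow_succ', Module.End.mul_apply, ih]; simp [pow_succ', mul_assoc]
  have h2 (y : ExteriorAlgebra K W) :
      ((TensorProduct.map a (LinearMap.id : _ →ₗ[K] ExteriorAlgebra K W)) ^ i) (m ⊗ₜ y) =
        (a ^ i) m ⊗ₜ y := by
    induction i with
    | zero => simp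
    | succ j ih => rw [pow_succ', Module.End.mul_apply, ih]; simp [pow_succ']
  rw [← Nat.cast_comm, ← nsmul_eq_mul, LinearMap.smul_apply, Module.End.mul_apply, h1, smul_pow,
    LinearMap.smul_apply, mul_one, h2, mul_smul, Nat.cast_smul_eq_nsmul]

theorem map_lefschetzOp_le {A : ℤ → Submodule K M} {a : M →ₗ[K] M}
    (ha : ∀ i, (A i).map a ≤ A (i + 2)) {ξ : ExteriorAlgebra K W} (hξ : ξ ∈ ⋀[K]^2 W) (μ : K)
    (n : ℤ) : (tensorGrading A (intGrading K W) n).map (lefschetzOp μ a ξ) ≤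
      tensorGrading A (intGrading K W) (n + 2) := by
  refine Submodule.map_le_iff_le_comap.2 (tensorGrading_le_s4 fun i j hij m hm y hy => ?_)
  rw [Submodule.mem_comap, lefschetzOp_tmul]
  refine Submodule.add_mem _ (Submodule.smul_mem _ _
    (tmul_mem_tensorGrading_s4 (i := i + 2) (by omega) (ha i ⟨m, hm, rfl⟩) hy)) ?_
  rcases lt_or_ge j 0 with hj | hj
  · rw [intGrading_of_neg hj, Submodule.mem_bot] at hy
    simp [hy]
  lift j to ℕ using hj
  refine tmul_mem_tensorGrading_s4 (j := ((2 + j : ℕ) : ℤ)) (by push_cast; omega) hm ?_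
  rw [intGrading_natCast] at hy ⊢
  rw [exteriorPower, pow_add]
  exact Submodule.mul_mem_mul hξ hy

theorem lTensor_contract_mem {A : ℤ → Submodule K M} (φ : Module.Dual K W) {n : ℤ}
    {x : M ⊗[K] ExteriorAlgebra K W} (hx : x ∈ tensorGrading A (intGrading K W) n) :
    (contract φ).lTensor M x ∈ tensorGrading A (intGrading K W) (n - 1) := by
  have : tensorGrading A (intGrading K W) n ≤
      (tensorGrading A (intGrading K W) (n - 1)).comap ((contract φ).lTensor M) :=
    tensorGrading_le_s4 fun i j hij m hm y hy => by
      rw [Submodule.mem_comap, LinearMap.lTensor_tmul]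
      exact tmul_mem_tensorGrading_s4 (by omega) hm (contract_mem_intGrading φ hy)
  exact this hx

/-- Contracting an element killed by `L ^ k` gives an element killed by `L ^ (k + 1)`. -/
theorem lefschetzOp_pow_succ_lTensor_contract (μ : K) (a : M →ₗ[K] M)
    {ξ : ExteriorAlgebra K W} (hξ : ξ ∈ ⋀[K]^2 W) (φ : Module.Dual K W) {k : ℕ}
    {x : M ⊗[K] ExteriorAlgebra K W} (hx : (lefschetzOp μ a ξ ^ k) x = 0) :
    (lefschetzOp μ a ξ ^ (k + 1)) ((contract φ).lTensor M x) = 0 := by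
  set L := lefschetzOp μ a ξ with hL
  let D : Module.End K (M ⊗[K] ExteriorAlgebra K W) := (contract φ).lTensor M
  let X : Module.End K (M ⊗[K] ExteriorAlgebra K W) :=
    (LinearMap.mulLeft K (contract φ ξ)).lTensor M
  have hXL : X * L = L * X := by
    obtain ⟨w, hw⟩ := exists_contract_eq_ι φ hξ
    refine TensorProduct.ext' fun m y => ?_
    have hc : ι K w * (ξ * y) = ξ * (ι K w * y) := by
      rw [← mul_assoc, ← mul_assoc, (commute_ι_of_mem_two hξ w).eq]
    simp [X, hL, hw, hc]
  have hDL : D * L = L * D + X := by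
    refine TensorProduct.ext' fun m y => ?_
    simp only [Module.End.mul_apply, LinearMap.add_apply, D, X, hL, lefschetzOp_tmul, map_add,
      map_smul, LinearMap.lTensor_tmul, LinearMap.mulLeft_apply, contract_mul_of_mem_two φ hξ,
      TensorProduct.tmul_add]
    abel
  have key (j : ℕ) : D * L ^ (j + 1) = L ^ (j + 1) * D + (j + 1) • (X * L ^ j) := by
    induction j with
    | zero => simpa using hDL
    | succ j ih =>
      have hX : L ^ (j + 1) * X = X * L ^ (j + 1) := ((show Commute X L from hXL).pow_right _).eq.symm
      rw [pow_succ, ← mul_assoc, ih, add_mul, mul_assoc, hDL, mul_add, hX, smul_mul_assoc,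
        mul_assoc X, ← pow_succ, add_smul (j + 1) 1, one_smul, mul_assoc]
      abel
  have h0 : (L ^ (k + 1)) x = 0 := by rw [pow_succ', Module.End.mul_apply, hx, map_zero]
  have := LinearMap.congr_fun (key k) x
  simp only [LinearMap.add_apply, Module.End.mul_apply, h0, hx, map_zero, LinearMap.smul_apply,
    smul_zero, add_zero] at this
  exact this.symm

/-- The injectivity half of the hard Lefschetz property for `M ⊗ ⋀W`. -/
theorem eq_zero_of_lefschetzOp_pow_eq_zero [CharZero K] [FiniteDimensional K W] {R g : ℕ}
    {A : ℤ → Submodule K M} (hA : ∀ i < 0, A i = ⊥) {a : M →ₗ[K] M}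
    (ha : ∀ k : ℕ, Disjoint (LinearMap.ker (a ^ k)) (A (R - k)))
    {ξ : ExteriorAlgebra K W} (hξ : ξ ∈ ⋀[K]^2 W) (hg : ξ ^ g ≠ 0) {μ : K} (hμ : μ ≠ 0)
    (k : ℕ) (x : M ⊗[K] ExteriorAlgebra K W)
    (hx : x ∈ tensorGrading A (intGrading K W) (R + g - k))
    (hLx : (lefschetzOp μ a ξ ^ k) x = 0) : x = 0 := by
  induction hd : R + g + 1 - k generalizing k x with
  | zero =>
    rw [tensorGrading_eq_bot hA (fun _ => intGrading_of_neg) (by omega)] at hx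
    exact hx
  | succ d ih =>
    obtain ⟨m, hm, rfl⟩ := exists_tmul_one_of_contract_eq_zero hx fun φ =>
      ih (k + 1) _ (by
        have := lTensor_contract_mem φ hx
        rwa [show (R + g - k - 1 : ℤ) = R + g - (k + 1 : ℕ) by push_cast; ring] at this)
        (lefschetzOp_pow_succ_lTensor_contract μ a hξ φ hLx) (by omega)
    have hJ : ξ ^ min k g ≠ 0 := fun h => hg (pow_eq_zero_of_le (min_le_right k g) h)
    obtain ⟨l, hl1, hl0⟩ := exists_functional_pow hξ hJ
    have hsum := congrArg ((TensorProduct.rid K M).toLinearMap ∘ₗ l.lTensor M) hLx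
    rw [lefschetzOp_pow_tmul_one, map_sum, map_zero,
      Finset.sum_eq_single_of_mem (k - min k g) (by simp) fun i hi hne => by
        simp [hl0 (k - i) (by simp at hi; omega)]] at hsum
    rw [Nat.sub_sub_self (min_le_left k g)] at hsum
    have hc : k.choose (min k g) ≠ 0 := (Nat.choose_pos (min_le_left k g)).ne'
    have ham : (a ^ (k - min k g)) m = 0 := by simpa [hl1, hc, hμ] using hsum
    suffices m = 0 by simp [this]
    rcases le_total k g with h | h
    · simpa [h] using ham
    · refine Submodule.disjoint_def.1 (ha (k - min k g)) m ham ?_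
      rwa [show ((R : ℤ) - (k - min k g : ℕ)) = R + g - k by rw [min_eq_right h]; omega]

/-- On degree zero the top power of the Lefschetz operator has a single surviving term. -/
theorem lefschetzOp_pow_add_tmul_one [FiniteDimensional K W] {R g : ℕ}
    {A : ℤ → Submodule K M} (hA : ∀ i : ℤ, 2 * R < i → A i = ⊥) {a : M →ₗ[K] M}
    (ha : ∀ i, (A i).map a ≤ A (i + 2)) (hW : Module.finrank K W = 2 * g)
    {ξ : ExteriorAlgebra K W} (hξ : ξ ∈ ⋀[K]^2 W) (μ : K) {m : M} (hm : m ∈ A 0) :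
    (lefschetzOp μ a ξ ^ (R + g)) (m ⊗ₜ 1) =
      (((R + g).choose R : K) * μ ^ R) • ((a ^ R) m ⊗ₜ[K] (ξ ^ g)) := by
  have ham (i : ℕ) : (a ^ i) m ∈ A (2 * i : ℤ) := by
    induction i with
    | zero => simpa using hm
    | succ i ih =>
      rw [pow_succ', Module.End.mul_apply, Nat.cast_succ, mul_add, mul_one]
      exact ha _ ⟨_, ih, rfl⟩
  rw [lefschetzOp_pow_tmul_one, Finset.sum_eq_single_of_mem R (by simp), Nat.add_sub_cancel_left]
  intro i hi hne
  rcases lt_or_gt_of_ne hne with h | h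
  · have := pow_mem_exteriorPower hξ (R + g - i)
    rw [exteriorPower_eq_bot (by omega), Submodule.mem_bot] at this
    simp [this]
  · have := ham i
    rw [hA _ (by omega), Submodule.mem_bot] at this
    simp [this]

end LefschetzOperator

/-- Let `K` be a field of characteristic zero.  Let `(H, a)` be a graded
Lefschetz structure of weight `R ≥ 1` (an internal `ℤ`-grading `Hp` of a finite-dimensional
vector space `VH` with degree-2 operator `aOp` such that `aOp^k : H_{R−k} → H_{R+k}` is an
isomorphism for all `k ≥ 0`), concentrated in degrees `0` through `2R`, with `H_0 ≠ 0`.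
Let `W` be a `K`-vector space of dimension `2g`, `ξ ∈ ⋀²W`, and `μ ∈ K`.  Equip
`V = H ⊗ ⋀W` with the grading `V_n = ⊕_{i+j=n} H_i ⊗ ⋀^j W` and the degree-2 operator
`L = μ (a ⊗ 1) + 1 ⊗ (ξ ∧ −)`.  Then `L^k : V_{R+g−k} → V_{R+g+k}` is an isomorphism for
every `k ≥ 0` if and only if `μ ≠ 0` and `ξ^g ≠ 0` in `⋀^{2g}W`. -/
theorem lefschetz_tensor_exterior_iff
    (K VH W : Type*) [Field K] [CharZero K]
    [AddCommGroup VH] [Module K VH] [FiniteDimensional K VH]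
    [AddCommGroup W] [Module K W] [FiniteDimensional K W]
    (R g : ℕ) (hR : 1 ≤ R)
    (Hp : ℤ → Submodule K VH) (hHp : DirectSum.IsInternal Hp)
    (hconc : ∀ i : ℤ, i < 0 ∨ (2 * R : ℤ) < i → Hp i = ⊥)
    (hH0 : Hp 0 ≠ ⊥)
    (aOp : VH →ₗ[K] VH) (haOp2 : ∀ i, (Hp i).map aOp ≤ Hp (i + 2))
    (haL : ∀ k : ℕ, (Hp ((R : ℤ) - k)).map (aOp ^ k) = Hp ((R : ℤ) + k) ∧
      Disjoint (LinearMap.ker (aOp ^ k)) (Hp ((R : ℤ) - k)))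
    (hdimW : Module.finrank K W = 2 * g)
    (ξ : ExteriorAlgebra K W) (hξ : ξ ∈ ⋀[K]^2 W) (μ : K)
    (E : ℤ → Submodule K (ExteriorAlgebra K W))
    (hE : ∀ j : ℤ, E j = if 0 ≤ j then ⋀[K]^(j.toNat) W else ⊥)
    (C : ℤ → Submodule K (VH ⊗[K] ExteriorAlgebra K W))
    (hC : ∀ n : ℤ, C n = ⨆ p : ℤ × ℤ, ⨆ _ : p.1 + p.2 = n,
      LinearMap.range (TensorProduct.map (Hp p.1).subtype (E p.2).subtype))
    (L : VH ⊗[K] ExteriorAlgebra K W →ₗ[K] VH ⊗[K] ExteriorAlgebra K W)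
    (hL : L = μ • TensorProduct.map aOp LinearMap.id +
      TensorProduct.map LinearMap.id (LinearMap.mulLeft K ξ)) :
    (∀ k : ℕ, (C ((R : ℤ) + g - k)).map (L ^ k) = C ((R : ℤ) + g + k) ∧
      Disjoint (LinearMap.ker (L ^ k)) (C ((R : ℤ) + g - k))) ↔
    (μ ≠ 0 ∧ ξ ^ g ≠ 0) := by
  obtain rfl : E = intGrading K W := funext hE
  obtain rfl : C = tensorGrading Hp (intGrading K W) := funext hC
  obtain rfl : L = lefschetzOp μ aOp ξ := hL
  constructor
  · intro h
    obtain ⟨m, hm, hm0⟩ := Submodule.exists_mem_ne_zero_of_ne_bot hH0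
    have h1 : m ⊗ₜ[K] (1 : ExteriorAlgebra K W) ≠ 0 := by
      intro h0
      apply hm0
      simpa using congrArg ((TensorProduct.rid K VH).toLinearMap ∘ₗ
        (algebraMapInv (R := K) (M := W)).toLinearMap.lTensor VH) h0
    have hmem : m ⊗ₜ[K] (1 : ExteriorAlgebra K W) ∈
        tensorGrading Hp (intGrading K W) ((R : ℤ) + g - (R + g : ℕ)) := by
      refine tmul_mem_tensorGrading_s4 (i := 0) (j := (0 : ℕ)) (by push_cast; ring) hm ?_
      rw [intGrading_natCast, exteriorPower, pow_zero]
      exact Submodule.one_le.1 le_rfl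
    have hne : (lefschetzOp μ aOp ξ ^ (R + g)) (m ⊗ₜ 1) ≠ 0 := fun h0 =>
      h1 (Submodule.disjoint_def.1 (h (R + g)).2 _ h0 hmem)
    rw [lefschetzOp_pow_add_tmul_one (fun i hi => hconc i (Or.inr hi)) haOp2 hdimW hξ μ hm] at hne
    refine ⟨?_, ?_⟩
    · rintro rfl
      exact hne (by simp [zero_pow (by omega : R ≠ 0)])
    · intro h0
      exact hne (by simp [h0])
  · rintro ⟨hμ, hg⟩ k
    have hdisj : Disjoint (LinearMap.ker (lefschetzOp μ aOp ξ ^ k))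
        (tensorGrading Hp (intGrading K W) ((R : ℤ) + g - k)) :=
      Submodule.disjoint_def.2 fun x hx hxC =>
        eq_zero_of_lefschetzOp_pow_eq_zero (fun i hi => hconc i (Or.inl hi)) (fun k => (haL k).2)
          hξ hg hμ k x hxC hx
    refine ⟨Submodule.eq_of_le_of_finrank_le ?_ ?_, hdisj⟩
    · have := map_pow_tensorGrading_le (map_lefschetzOp_le haOp2 hξ μ) k ((R : ℤ) + g - k)
      rwa [show (R + g - k + k * 2 : ℤ) = R + g + k by ring] at this
    · have hfin (k : ℕ) :
          Module.finrank K (Hp ((R : ℤ) + k)) = Module.finrank K (Hp ((R : ℤ) - k)) := by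
        rw [← (haL k).1]
        exact Submodule.finrank_map_of_disjoint_ker (haL k).2
      obtain ⟨F, hF⟩ := hHp.exists_le_map (fun i => Hp (2 * R - i)) fun i => by
        rcases le_total i R with hi | hi
        · obtain ⟨j, rfl⟩ : ∃ j : ℕ, i = R - j := ⟨(R - i).toNat, by omega⟩
          rw [show (2 * R - (R - j) : ℤ) = R + j by ring, hfin]
        · obtain ⟨j, rfl⟩ : ∃ j : ℕ, i = R + j := ⟨(i - R).toNat, by omega⟩
          rw [show (2 * R - (R + j) : ℤ) = R - j by ring, hfin]
      obtain ⟨G, hG⟩ := exists_intGrading_le_map (K := K) (W := W)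
      have hle := tensorGrading_le_map hF hG ((R : ℤ) + g - k)
      rw [hdimW, show (2 * R + (2 * g : ℕ) - (R + g - k) : ℤ) = R + g + k by
        push_cast; ring] at hle
      rw [Submodule.finrank_map_of_disjoint_ker hdisj]
      exact (Submodule.finrank_mono hle).trans (Submodule.finrank_map_le _ _)
end
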